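/- arXiv:2406.15682 — 3 statements merged into one kernel-verified Lean document; each statement's English description precedes it below -/
import Mathlib

section
/- Let V(u,w) = (1/2)(u,w)'M(u,w) + (u,w)'d with block matrix M = [[M₁₁, M₁₂],[M₁₂', M₂₂]], where M₁₁ ∈ ℝ^{m×m} is positive semidefinite, M₂₂ ∈ ℝ^{n×n} is negative semidefinite, and d ∈ R(M). Then strong duality holds: min_u max_w V(u,w) = max_w min_u V(u,w) = V(u*,w*), where the saddle points (u*,w*) of V are exactly the points (u*,w*) ∈ −M⁺d + N(M); the common optimal value is −(1/2)d'M⁺d, and the derivative of V with respect to (u,w) vanishes at every saddle point. -/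
open Matrix Set

noncomputable section

/-- `Ap` is the Moore–Penrose pseudoinverse of `A`. -/
def IsMoorePenrose {m n : Type*} [Fintype m] [Fintype n] (A : Matrix m n ℝ)
    (Ap : Matrix n m ℝ) : Prop :=
  A * Ap * A = A ∧ Ap * A * Ap = Ap ∧ (A * Ap)ᵀ = A * Ap ∧ (Ap * A)ᵀ = Ap * A

/-- `v` is the optimal value of `min_u max_w f u w`. -/
def MinMaxValue {α β : Type*} (f : α → β → ℝ) (v : ℝ) : Prop :=
  IsLeast {r | ∃ u, IsGreatest {s | ∃ w, s = f u w} r} v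

/-- `v` is the optimal value of `max_w min_u f u w`. -/
def MaxMinValue {α β : Type*} (f : α → β → ℝ) (v : ℝ) : Prop :=
  IsGreatest {r | ∃ w, IsLeast {s | ∃ u, s = f u w} r} v

lemma quad_expand {ι : Type*} [Fintype ι] (M : Matrix ι ι ℝ) (hM : Mᵀ = M) (d z h : ι → ℝ) :
    (1/2) * ((z + h) ⬝ᵥ M.mulVec (z + h)) + (z + h) ⬝ᵥ d =
      ((1/2) * (z ⬝ᵥ M.mulVec z) + z ⬝ᵥ d) + h ⬝ᵥ (M.mulVec z + d)
        + (1/2) * (h ⬝ᵥ M.mulVec h) := by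
  have h1 : z ⬝ᵥ M.mulVec h = h ⬝ᵥ M.mulVec z := by
    rw [dotProduct_mulVec, ← mulVec_transpose, hM, dotProduct_comm]
  simp only [mulVec_add, dotProduct_add, add_dotProduct, h1]
  ring

lemma lin_zero (a b : ℝ) (h : ∀ t : ℝ, 0 ≤ t * a + t ^ 2 * b) : a = 0 := by
  by_contra ha
  have hb : 0 < |b| + 1 := by positivity
  have h1 := h (-(a / (|b| + 1)))
  have h3 : b ≤ |b| := le_abs_self b
  have h4 : 0 < (a / (|b| + 1)) ^ 2 := by positivity
  have h5 : a = (a / (|b| + 1)) * (|b| + 1) := by field_simp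
  generalize a / (|b| + 1) = c at *
  subst h5
  nlinarith

lemma fderiv_quad {ι : Type*} [Fintype ι] (M : Matrix ι ι ℝ) (hM : Mᵀ = M) (d z : ι → ℝ)
    (hz : M.mulVec z + d = 0) :
    fderiv ℝ (fun z : ι → ℝ => (1/2) * (z ⬝ᵥ M.mulVec z) + z ⬝ᵥ d) z = 0 := by
  have hdiff : DifferentiableAt ℝ (fun z : ι → ℝ => (1/2) * (z ⬝ᵥ M.mulVec z) + z ⬝ᵥ d) z := by
    simp only [dotProduct, mulVec]
    fun_prop
  ext1 h
  rw [← hdiff.lineDeriv_eq_fderiv]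
  unfold lineDeriv
  simp only [quad_expand M hM, hz, mulVec_smul, dotProduct_smul, smul_dotProduct, dotProduct_zero,
    smul_eq_mul]
  have : HasDerivAt (fun t : ℝ => (1/2) * (z ⬝ᵥ M.mulVec z) + z ⬝ᵥ d + t * 0
      + (1/2) * (t * (t * (h ⬝ᵥ M.mulVec h)))) 0 0 := by
    have h1 := (((hasDerivAt_id (0:ℝ)).pow 2).mul_const ((1/2) * (h ⬝ᵥ M.mulVec h))).const_add
      ((1/2) * (z ⬝ᵥ M.mulVec z) + z ⬝ᵥ d)
    refine (h1.congr_deriv (by simp)).congr_of_eventuallyEq (Filter.Eventually.of_forall ?_)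
    intro t
    simp
    ring
  simp [this.deriv]

/-- Saddle-point theorem for quadratic functions: for
`V(u,w) = (1/2)(u,w)'M(u,w) + (u,w)'d` with `M₁₁ ⪰ 0`, `M₂₂ ⪯ 0`, and `d ∈ R(M)`,
strong duality holds: `min_u max_w V = max_w min_u V = V(u*,w*) = −(1/2)d'M⁺d`; the
saddle points are exactly the points `(u*,w*) ∈ −M⁺d + N(M)`; and the derivative of `V`
vanishes at every saddle point. -/
theorem stmt8 {m n : ℕ} (M11 : Matrix (Fin m) (Fin m) ℝ) (M12 : Matrix (Fin m) (Fin n) ℝ)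
    (M22 : Matrix (Fin n) (Fin n) ℝ)
    (h11 : M11.PosSemidef) (h22 : (-M22).PosSemidef)
    (d : Fin m ⊕ Fin n → ℝ)
    (Mp : Matrix (Fin m ⊕ Fin n) (Fin m ⊕ Fin n) ℝ)
    (hMp : IsMoorePenrose (Matrix.fromBlocks M11 M12 M12ᵀ M22) Mp)
    (hd : d ∈ Set.range (Matrix.fromBlocks M11 M12 M12ᵀ M22).mulVec) :
    let M := Matrix.fromBlocks M11 M12 M12ᵀ M22
    let V : (Fin m → ℝ) → (Fin n → ℝ) → ℝ := fun u w =>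
      (1/2) * (Sum.elim u w ⬝ᵥ M.mulVec (Sum.elim u w)) + Sum.elim u w ⬝ᵥ d
    let Saddle : ((Fin m → ℝ) × (Fin n → ℝ)) → Prop := fun p =>
      ∀ (u : Fin m → ℝ) (w : Fin n → ℝ), V p.1 w ≤ V p.1 p.2 ∧ V p.1 p.2 ≤ V u p.2
    -- the saddle points are exactly the points of −M⁺d + N(M)
    ({p : (Fin m → ℝ) × (Fin n → ℝ) | Saddle p} =
      {p : (Fin m → ℝ) × (Fin n → ℝ) |
        ∃ q, M.mulVec q = 0 ∧ Sum.elim p.1 p.2 = -Mp.mulVec d + q}) ∧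
    -- the common optimal value is −(1/2)d'M⁺d, achieved at every saddle point
    (∀ p : (Fin m → ℝ) × (Fin n → ℝ), Saddle p →
      V p.1 p.2 = -(1/2) * (d ⬝ᵥ Mp.mulVec d)) ∧
    -- strong duality: min max = max min = −(1/2)d'M⁺d
    MinMaxValue V (-(1/2) * (d ⬝ᵥ Mp.mulVec d)) ∧
    MaxMinValue V (-(1/2) * (d ⬝ᵥ Mp.mulVec d)) ∧
    -- the derivative of V vanishes at every saddle point
    (∀ p : (Fin m → ℝ) × (Fin n → ℝ), Saddle p →
      fderiv ℝ (fun z : Fin m ⊕ Fin n → ℝ => (1/2) * (z ⬝ᵥ M.mulVec z) + z ⬝ᵥ d)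
        (Sum.elim p.1 p.2) = 0) := by
  intro M V Saddle
  have hM : Mᵀ = M := by
    have e1 : M11ᵀ = M11 := by simpa using h11.isHermitian.eq
    have e2 : M22ᵀ = M22 := by
      have := h22.isHermitian.eq
      simpa using this
    simp [M, fromBlocks_transpose, e1, e2]
  have hMM : M *ᵥ (Mp *ᵥ d) = d := by
    obtain ⟨y, rfl⟩ := hd
    rw [mulVec_mulVec, mulVec_mulVec]
    exact congrArg (· *ᵥ y) hMp.1
  have q1 : ∀ a : Fin m → ℝ, 0 ≤ Sum.elim a (0 : Fin n → ℝ) ⬝ᵥ M *ᵥ Sum.elim a 0 := by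
    intro a
    have := h11.dotProduct_mulVec_nonneg a
    simpa [M, fromBlocks_mulVec, dotProduct] using this
  have q2 : ∀ b : Fin n → ℝ, Sum.elim (0 : Fin m → ℝ) b ⬝ᵥ M *ᵥ Sum.elim 0 b ≤ 0 := by
    intro b
    have := h22.dotProduct_mulVec_nonneg b
    simpa [M, fromBlocks_mulVec, dotProduct, neg_mulVec] using this
  have x1 : ∀ u a w, V (u + a) w = V u w + Sum.elim a 0 ⬝ᵥ (M *ᵥ Sum.elim u w + d)
      + (1/2) * (Sum.elim a (0 : Fin n → ℝ) ⬝ᵥ M *ᵥ Sum.elim a 0) := by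
    intro u a w
    have e : Sum.elim (u + a) w = Sum.elim u w + Sum.elim a 0 := by
      ext (i | i) <;> simp
    simp only [V]
    rw [e, quad_expand M hM]
  have x2 : ∀ u w b, V u (w + b) = V u w + Sum.elim 0 b ⬝ᵥ (M *ᵥ Sum.elim u w + d)
      + (1/2) * (Sum.elim (0 : Fin m → ℝ) b ⬝ᵥ M *ᵥ Sum.elim 0 b) := by
    intro u w b
    have e : Sum.elim u (w + b) = Sum.elim u w + Sum.elim (0 : Fin m → ℝ) b := by
      ext (i | i) <;> simp
    simp only [V]
    rw [e, quad_expand M hM]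
  have key : ∀ p, Saddle p ↔ M *ᵥ Sum.elim p.1 p.2 + d = 0 := by
    rintro ⟨u, w⟩
    constructor
    · intro hs
      have g1 : ∀ a : Fin m → ℝ, Sum.elim a 0 ⬝ᵥ (M *ᵥ Sum.elim u w + d) = 0 := by
        intro a
        apply lin_zero _ ((1/2) * (Sum.elim a (0 : Fin n → ℝ) ⬝ᵥ M *ᵥ Sum.elim a 0))
        intro t
        have h1 := (hs (u + t • a) w).2
        have e : Sum.elim (t • a) (0 : Fin n → ℝ) = t • Sum.elim a 0 := by
          ext (i | i) <;> simp
        simp only [x1, e, mulVec_smul, dotProduct_smul, smul_dotProduct, smul_eq_mul] at h1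
        linarith
      have g2 : ∀ b : Fin n → ℝ, Sum.elim 0 b ⬝ᵥ (M *ᵥ Sum.elim u w + d) = 0 := by
        intro b
        apply neg_eq_zero.mp
        apply lin_zero _ (-((1/2) * (Sum.elim (0 : Fin m → ℝ) b ⬝ᵥ M *ᵥ Sum.elim 0 b)))
        intro t
        have h1 := (hs u (w + t • b)).1
        have e : Sum.elim (0 : Fin m → ℝ) (t • b) = t • Sum.elim (0 : Fin m → ℝ) b := by
          ext (i | i) <;> simp
        simp only [x2, e, mulVec_smul, dotProduct_smul, smul_dotProduct, smul_eq_mul] at h1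
        linarith
      show M *ᵥ Sum.elim u w + d = 0
      generalize M *ᵥ Sum.elim u w + d = g at g1 g2
      ext (i | i)
      · have := g1 (Pi.single i 1)
        simpa [dotProduct, Pi.single_apply] using this
      · have := g2 (Pi.single i 1)
        simpa [dotProduct, Pi.single_apply] using this
    · intro h0 u' w'
      have y1 := x1 u (u' - u) w
      have y2 := x2 u w (w' - w)
      simp only at h0
      rw [h0, dotProduct_zero, add_sub_cancel] at y1 y2
      have := q1 (u' - u)
      have := q2 (w' - w)
      constructor <;> simp only <;> linarith
  have val : ∀ p, Saddle p → V p.1 p.2 = -(1/2) * (d ⬝ᵥ Mp.mulVec d) := by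
    intro p hp
    have h0 := (key p).1 hp
    have h1 : M *ᵥ Sum.elim p.1 p.2 = -d := eq_neg_of_add_eq_zero_left h0
    have h2 : Sum.elim p.1 p.2 ⬝ᵥ d = -(d ⬝ᵥ Mp *ᵥ d) := by
      conv_lhs => rw [← hMM]
      rw [dotProduct_mulVec, ← mulVec_transpose, hM, h1, neg_dotProduct]
    simp only [V]
    rw [h1, dotProduct_neg, h2]
    ring
  have ex : ∃ p, Saddle p := by
    refine ⟨(fun i => (-(Mp *ᵥ d)) (Sum.inl i), fun i => (-(Mp *ᵥ d)) (Sum.inr i)), ?_⟩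
    rw [key]
    have e : Sum.elim (fun i => (-(Mp *ᵥ d)) (Sum.inl i)) (fun i => (-(Mp *ᵥ d)) (Sum.inr i))
        = -(Mp *ᵥ d) := by
      ext (i | i) <;> simp
    simp only
    rw [e, mulVec_neg, hMM, neg_add_cancel]
  refine ⟨?_, val, ?_, ?_, ?_⟩
  · ext p
    simp only [mem_ofPred_eq]
    rw [key]
    constructor
    · intro h0
      refine ⟨Sum.elim p.1 p.2 + Mp *ᵥ d, ?_, by abel⟩
      rw [mulVec_add, hMM, h0]
    · rintro ⟨q, hq, e⟩
      rw [e, mulVec_add, mulVec_neg, hMM, hq]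
      abel
  · obtain ⟨p, hp⟩ := ex
    rw [← val p hp]
    refine ⟨⟨p.1, ⟨p.2, rfl⟩, ?_⟩, ?_⟩
    · rintro _ ⟨w, rfl⟩
      exact (hp p.1 w).1
    · rintro r ⟨u, hr⟩
      exact ((hp u p.2).2).trans (hr.2 ⟨p.2, rfl⟩)
  · obtain ⟨p, hp⟩ := ex
    rw [← val p hp]
    refine ⟨⟨p.2, ⟨p.1, rfl⟩, ?_⟩, ?_⟩
    · rintro _ ⟨u, rfl⟩
      exact (hp u p.2).2
    · rintro r ⟨w, hr⟩
      exact (hr.2 ⟨p.1, rfl⟩).trans (hp p.1 w).1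
  · intro p hp
    exact fderiv_quad M hM d _ ((key p).1 hp)
end
end

section
/- Let D ∈ ℝ^{n×n} be positive semidefinite, d ∈ ℝ^n, V(w) = (1/2)w'Dw + w'd, W = {w ∈ ℝ^n : w'w = 1}, L(w,λ) = V(w) − (1/2)λ(w'w − 1), and let λ_P be the largest real eigenvalue of the 2n×2n matrix P = [[D, I],[dd', D]]. Then: (1) the constrained problem max_{w∈W} V(w), the Lagrangian problem max_w min_λ L(w,λ), and the dual Lagrangian problem min_λ max_w L(w,λ) all have solutions, with common optimal value V⁰ = −(1/2)d'(D − λ_P I)⁺d + λ_P/2; (2) strong duality holds between the Lagrangian and dual Lagrangian problems, the saddle points of L are (w*, λ*) with λ* = λ_P and w* = (−(D − λ_P I)⁺d + N(D − λ_P I)) ∩ W if λ_P = ‖D‖, or w* = −(D − λ_P I)^{−1}d if λ_P > ‖D‖; and (3) the set of maximizers of V over W equals w*. -/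
open Matrix Set

noncomputable section

/-- The spectral norm of a real square matrix: `sup {|v'Av| : ‖v‖ = 1}` (for a symmetric
positive semidefinite matrix this is the largest eigenvalue). -/
def specNorm {n : Type*} [Fintype n] (A : Matrix n n ℝ) : ℝ :=
  sSup {r | ∃ v : n → ℝ, v ⬝ᵥ v = 1 ∧ r = |v ⬝ᵥ A.mulVec v|}

theorem hsymm {n : ℕ} {D : Matrix (Fin n) (Fin n) ℝ} (hD : Dᵀ = D) (x y : Fin n → ℝ) :
    x ⬝ᵥ D *ᵥ y = y ⬝ᵥ D *ᵥ x := by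
  rw [dotProduct_comm, ← Matrix.vecMul_transpose, hD, ← Matrix.dotProduct_mulVec]

theorem nonneg_of_pos {f : ℝ → ℝ} (hf : Continuous f) (h : ∀ e, 0 < e → 0 ≤ f e) : 0 ≤ f 0 := by
  have h1 : Filter.Tendsto f (nhdsWithin 0 (Set.Ioi 0)) (nhds (f 0)) :=
    (hf.tendsto 0).mono_left nhdsWithin_le_nhds
  exact ge_of_tendsto h1 (Filter.eventually_of_mem self_mem_nhdsWithin h)

theorem exists_max {n : ℕ} (hn : 0 < n) (D : Matrix (Fin n) (Fin n) ℝ) (d : Fin n → ℝ) :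
    ∃ w : Fin n → ℝ, w ⬝ᵥ w = 1 ∧ ∀ u : Fin n → ℝ, u ⬝ᵥ u = 1 →
      (1/2) * (u ⬝ᵥ D *ᵥ u) + u ⬝ᵥ d ≤ (1/2) * (w ⬝ᵥ D *ᵥ w) + w ⬝ᵥ d := by
  have hc : IsCompact {w : Fin n → ℝ | w ⬝ᵥ w = 1} := by
    apply Metric.isCompact_of_isClosed_isBounded
    · exact isClosed_eq (by fun_prop) continuous_const
    · refine (Metric.isBounded_closedBall (x := (0 : Fin n → ℝ)) (r := 1)).subset ?_
      intro w hw
      have hw : w ⬝ᵥ w = 1 := hw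
      rw [mem_closedBall_zero_iff, pi_norm_le_iff_of_nonneg zero_le_one]
      intro i
      rw [Real.norm_eq_abs, ← sq_le_one_iff_abs_le_one, ← hw]
      have := Finset.single_le_sum (f := fun j => w j * w j)
        (fun j _ => mul_self_nonneg _) (Finset.mem_univ i)
      rw [sq]; exact this
  have hne : {w : Fin n → ℝ | w ⬝ᵥ w = 1}.Nonempty := ⟨Pi.single ⟨0, hn⟩ 1, by simp⟩
  have hcont : Continuous fun w : Fin n → ℝ => (1/2) * (w ⬝ᵥ D *ᵥ w) + w ⬝ᵥ d := by
    fun_prop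
  obtain ⟨w, hw, hm⟩ := hc.exists_isMaxOn hne hcont.continuousOn
  exact ⟨w, hw, fun u hu => hm hu⟩

theorem kkt {n : ℕ} {D : Matrix (Fin n) (Fin n) ℝ} (hD : Dᵀ = D) (d w : Fin n → ℝ)
    (hw : w ⬝ᵥ w = 1) (hm : ∀ u : Fin n → ℝ, u ⬝ᵥ u = 1 →
      (1/2) * (u ⬝ᵥ D *ᵥ u) + u ⬝ᵥ d ≤ (1/2) * (w ⬝ᵥ D *ᵥ w) + w ⬝ᵥ d) :
    ∃ l : ℝ, D *ᵥ w + d = l • w ∧ ∀ z : Fin n → ℝ, z ⬝ᵥ D *ᵥ z ≤ l * (z ⬝ᵥ z) := by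
  have key : ∀ z : Fin n → ℝ, 0 < z ⬝ᵥ z →
      (w ⬝ᵥ z)^2 * (z ⬝ᵥ D *ᵥ z) ≤ (w ⬝ᵥ z) * (z ⬝ᵥ (D *ᵥ w + d)) * (z ⬝ᵥ z) := by
    intro z hz
    have hzw : z ⬝ᵥ w = w ⬝ᵥ z := dotProduct_comm _ _
    have hs := hsymm hD w z
    obtain ⟨t, ht⟩ : ∃ t, t * (z ⬝ᵥ z) = 2 * (w ⬝ᵥ z) :=
      ⟨2 * (w ⬝ᵥ z) / (z ⬝ᵥ z), by field_simp⟩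
    have h := hm (w - t • z) (by
      simp only [sub_dotProduct, dotProduct_sub, smul_dotProduct, dotProduct_smul, smul_eq_mul,
        hzw, hw]
      linear_combination t * ht)
    simp only [sub_dotProduct, dotProduct_sub, smul_dotProduct, dotProduct_smul, smul_eq_mul,
      mulVec_sub, mulVec_smul, hs] at h
    rw [dotProduct_add]
    have h2 : 0 ≤ (t * (z ⬝ᵥ D *ᵥ w + z ⬝ᵥ d) - t^2 / 2 * (z ⬝ᵥ D *ᵥ z)) := by linarith
    have h3 := mul_nonneg h2 (mul_nonneg hz.le hz.le)
    have h4 : (t * (z ⬝ᵥ D *ᵥ w + z ⬝ᵥ d) - t^2 / 2 * (z ⬝ᵥ D *ᵥ z)) * ((z ⬝ᵥ z) * (z ⬝ᵥ z))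
        = (t * (z ⬝ᵥ z)) * (z ⬝ᵥ D *ᵥ w + z ⬝ᵥ d) * (z ⬝ᵥ z)
          - (t * (z ⬝ᵥ z))^2 / 2 * (z ⬝ᵥ D *ᵥ z) := by ring
    rw [h4, ht] at h3
    linarith
  set g := D *ᵥ w + d with hg
  have key2 : ∀ z : Fin n → ℝ, w ⬝ᵥ z = 0 → 0 < z ⬝ᵥ z → ∀ e : ℝ, 0 < e →
      e * ((z ⬝ᵥ D *ᵥ z) + 2 * e * (z ⬝ᵥ D *ᵥ w) + e^2 * (w ⬝ᵥ D *ᵥ w)) ≤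
        (z ⬝ᵥ g + e * (w ⬝ᵥ g)) * (z ⬝ᵥ z + e^2) := by
    intro z hz hzz e he
    have hzw : z ⬝ᵥ w = 0 := by rw [dotProduct_comm]; exact hz
    have hs := hsymm hD w z
    have hn : (z + e • w) ⬝ᵥ (z + e • w) = z ⬝ᵥ z + e^2 := by
      simp only [add_dotProduct, dotProduct_add, smul_dotProduct, dotProduct_smul, smul_eq_mul,
        hz, hzw, hw]
      ring
    have h := key (z + e • w) (by rw [hn]; positivity)
    rw [hn] at h
    simp only [add_dotProduct, dotProduct_add, smul_dotProduct, dotProduct_smul, smul_eq_mul,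
      mulVec_add, mulVec_smul, hs, hz, hw] at h
    refine le_of_mul_le_mul_left ?_ he
    linarith
  have first : ∀ z : Fin n → ℝ, w ⬝ᵥ z = 0 → 0 < z ⬝ᵥ z → 0 ≤ z ⬝ᵥ g := by
    intro z hz hzz
    have h := nonneg_of_pos (f := fun e => (z ⬝ᵥ g + e * (w ⬝ᵥ g)) * (z ⬝ᵥ z + e^2) -
      e * ((z ⬝ᵥ D *ᵥ z) + 2 * e * (z ⬝ᵥ D *ᵥ w) + e^2 * (w ⬝ᵥ D *ᵥ w))) (by fun_prop)
      (fun e he => sub_nonneg.2 (key2 z hz hzz e he))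
    simp only [zero_mul, add_zero, ne_eq, OfNat.ofNat_ne_zero, not_false_eq_true, zero_pow,
      sub_zero] at h
    exact nonneg_of_mul_nonneg_left h hzz
  have hgw : g = (w ⬝ᵥ g) • w := by
    by_contra hne
    have hz0 : (w ⬝ᵥ g) • w - g ≠ 0 := fun h => hne (sub_eq_zero.1 h).symm
    have hp : 0 < ((w ⬝ᵥ g) • w - g) ⬝ᵥ ((w ⬝ᵥ g) • w - g) := by
      have := (dotProduct_star_self_pos_iff (v := (w ⬝ᵥ g) • w - g)).2 hz0
      simpa using this
    have ho : w ⬝ᵥ ((w ⬝ᵥ g) • w - g) = 0 := by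
      simp [dotProduct_sub, dotProduct_smul, hw]
    have h := first _ ho hp
    have h5 : ((w ⬝ᵥ g) • w - g) ⬝ᵥ ((w ⬝ᵥ g) • w - g) = - (((w ⬝ᵥ g) • w - g) ⬝ᵥ g) := by
      conv_lhs => rw [dotProduct_sub, dotProduct_smul, dotProduct_comm _ w, ho]
      simp
    linarith
  refine ⟨w ⬝ᵥ g, hgw, fun z => ?_⟩
  have hzz : 0 ≤ z ⬝ᵥ z := by simpa using dotProduct_star_self_nonneg z
  rcases hzz.eq_or_lt with h0 | hpos
  · have : z = 0 := dotProduct_self_eq_zero.1 h0.symm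
    simp [this]
  have hzg : z ⬝ᵥ g = (w ⬝ᵥ g) * (w ⬝ᵥ z) := by
    conv_lhs => rw [hgw, dotProduct_smul, dotProduct_comm z w, smul_eq_mul]
  by_cases ha : w ⬝ᵥ z = 0
  · have h := nonneg_of_pos (f := fun e => (w ⬝ᵥ g) * (z ⬝ᵥ z + e^2) -
      ((z ⬝ᵥ D *ᵥ z) + 2 * e * (z ⬝ᵥ D *ᵥ w) + e^2 * (w ⬝ᵥ D *ᵥ w))) (by fun_prop)
      (fun e he => by
        have h := key2 z ha hpos e he
        rw [hzg, ha] at h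
        refine sub_nonneg.2 (le_of_mul_le_mul_left ?_ he)
        linarith)
    simp only [mul_zero, zero_mul, add_zero, ne_eq, OfNat.ofNat_ne_zero, not_false_eq_true,
      zero_pow] at h
    linarith
  · have h := key z hpos
    rw [hzg] at h
    have : 0 < (w ⬝ᵥ z)^2 := by positivity
    refine le_of_mul_le_mul_left ?_ this
    linarith

/-- The key fact: `lamP I - D` is positive semidefinite and `d = (lamP I - D) w` is solvable on
the unit sphere. -/
theorem exists_w0 {n : ℕ} (D : Matrix (Fin n) (Fin n) ℝ) (hD : Dᵀ = D)
    (d : Fin n → ℝ) (lamP : ℝ)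
    (hlamP : IsGreatest
      {μ : ℝ | ∃ v : Fin n ⊕ Fin n → ℝ, v ≠ 0 ∧
        (Matrix.fromBlocks D 1 (Matrix.vecMulVec d d) D).mulVec v = μ • v} lamP) :
    (∀ z : Fin n → ℝ, z ⬝ᵥ D *ᵥ z ≤ lamP * (z ⬝ᵥ z)) ∧
      ∃ w : Fin n → ℝ, w ⬝ᵥ w = 1 ∧ D *ᵥ w + d = lamP • w := by
  obtain ⟨⟨v, hv0, hv⟩, hub⟩ := hlamP
  have hn : 0 < n := by
    rcases Nat.eq_zero_or_pos n with rfl | h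
    · exact absurd (Subsingleton.elim v 0) hv0
    · exact h
  have hP : ∀ (x y : Fin n → ℝ) (μ : ℝ),
      (Matrix.fromBlocks D 1 (Matrix.vecMulVec d d) D).mulVec (Sum.elim x y) = μ • Sum.elim x y ↔
      D *ᵥ x + y = μ • x ∧ (d ⬝ᵥ x) • d + D *ᵥ y = μ • y := by
    intro x y μ
    have hsm : μ • (Sum.elim x y : Fin n ⊕ Fin n → ℝ) = Sum.elim (μ • x) (μ • y) := by
      ext i; cases i <;> rfl
    rw [fromBlocks_mulVec, hsm, Sum.elim_eq_iff]
    simp [Function.comp_def, vecMulVec_mulVec]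
  obtain ⟨w, hw, hm⟩ := exists_max hn D d
  obtain ⟨l, hl, hpsd⟩ := kkt hD d w hw hm
  have hle : l ≤ lamP := by
    apply hub
    by_cases hdet : (l • (1 : Matrix (Fin n) (Fin n) ℝ) - D).det = 0
    · obtain ⟨q, hq0, hq⟩ := Matrix.exists_mulVec_eq_zero_iff.2 hdet
      rw [sub_mulVec, smul_mulVec, one_mulVec, sub_eq_zero] at hq
      have hdq : d ⬝ᵥ q = 0 := by
        have h1 : d = l • w - D *ᵥ w := by rw [← hl]; simp
        rw [h1, sub_dotProduct, smul_dotProduct, dotProduct_comm (D *ᵥ w), hsymm hD, ← hq]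
        simp
      refine ⟨Sum.elim q 0, ?_, (hP _ _ _).2 ⟨by simp [hq], by simp [hdq]⟩⟩
      intro h
      exact hq0 (funext fun i => congrFun h (Sum.inl i))
    · have hu : IsUnit (l • (1 : Matrix (Fin n) (Fin n) ℝ) - D).det := isUnit_iff_ne_zero.2 hdet
      obtain ⟨x, hx⟩ : ∃ x, (l • (1 : Matrix (Fin n) (Fin n) ℝ) - D) *ᵥ x = w :=
        ⟨(l • (1 : Matrix (Fin n) (Fin n) ℝ) - D)⁻¹ *ᵥ w, by
          rw [mulVec_mulVec, Matrix.mul_nonsing_inv _ hu, one_mulVec]⟩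
      rw [sub_mulVec, smul_mulVec, one_mulVec] at hx
      have hdx : d ⬝ᵥ x = 1 := by
        have h1 : d = l • w - D *ᵥ w := by rw [← hl]; simp
        rw [h1, sub_dotProduct, smul_dotProduct, dotProduct_comm (D *ᵥ w), hsymm hD,
          ← dotProduct_smul, ← dotProduct_sub, hx, hw]
      refine ⟨Sum.elim x w, ?_, (hP _ _ _).2 ⟨by rw [← hx]; simp, by rw [hdx, ← hl]; simp [add_comm]⟩⟩
      intro h
      have : w = 0 := funext fun i => congrFun h (Sum.inr i)
      simp [this] at hw
  have hnn : ∀ z : Fin n → ℝ, 0 ≤ z ⬝ᵥ z := fun z => by simpa using dotProduct_star_self_nonneg z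
  refine ⟨fun z => (hpsd z).trans (mul_le_mul_of_nonneg_right hle (hnn z)), ?_⟩
  rcases hle.eq_or_lt with rfl | hlt
  · exact ⟨w, hw, hl⟩
  have hinj : ∀ z : Fin n → ℝ, D *ᵥ z = lamP • z → z = 0 := by
    intro z hz
    have h1 := hpsd z
    rw [hz, dotProduct_smul, smul_eq_mul] at h1
    have h2 : z ⬝ᵥ z = 0 := by
      have := hnn z
      nlinarith
    exact dotProduct_self_eq_zero.1 h2
  obtain ⟨x, y, rfl⟩ : ∃ x y, v = Sum.elim x y :=
    ⟨v ∘ Sum.inl, v ∘ Sum.inr, (Sum.elim_comp_inl_inr v).symm⟩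
  obtain ⟨h1, h2⟩ := (hP _ _ _).1 hv
  have hc : d ⬝ᵥ x ≠ 0 := by
    intro hc
    rw [hc, zero_smul, zero_add] at h2
    have hy := hinj y h2
    rw [hy, add_zero] at h1
    apply hv0
    rw [hinj x h1, hy]
    ext i; cases i <;> rfl
  set c := d ⬝ᵥ x with hcdef
  have hu : D *ᵥ (c⁻¹ • y) + d = lamP • (c⁻¹ • y) := by
    rw [mulVec_smul, smul_comm lamP, ← h2, smul_add, smul_smul, inv_mul_cancel₀ hc, one_smul,
      add_comm]
  refine ⟨c⁻¹ • y, ?_, hu⟩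
  set u := c⁻¹ • y with hudef
  have hy : y = c • u := by rw [hudef, smul_smul, mul_inv_cancel₀ hc, one_smul]
  have e1 : c = lamP * (u ⬝ᵥ x) - u ⬝ᵥ D *ᵥ x := by
    have h3 : d = lamP • u - D *ᵥ u := by rw [← hu]; simp
    conv_lhs => rw [hcdef, h3, sub_dotProduct, smul_dotProduct, dotProduct_comm (D *ᵥ u), hsymm hD]
    rfl
  have e2 : u ⬝ᵥ D *ᵥ x + c * (u ⬝ᵥ u) = lamP * (u ⬝ᵥ x) := by
    have := congrArg (fun t => u ⬝ᵥ t) h1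
    simp only [hy, dotProduct_add, dotProduct_smul, smul_eq_mul] at this
    exact this
  have e3 : c * (u ⬝ᵥ u) = c * 1 := by linarith
  exact mul_left_cancel₀ hc e3

/-- Constrained quadratic optimization (trust-region problem): for `D ⪰ 0`,
`V(w) = (1/2)w'Dw + w'd`, `W = {w : w'w = 1}`,
`L(w,λ) = V(w) − (1/2)λ(w'w−1)`, and `λ_P` the largest real eigenvalue of
`P = [[D,I],[dd',D]]`:
(1) the constrained problem `max_{w∈W} V`, the Lagrangian problem `max_w min_λ L`, and
the dual Lagrangian problem `min_λ max_w L` all have solutions, with common optimal value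
`V⁰ = −(1/2)d'(D−λ_P I)⁺d + λ_P/2` (in particular strong duality holds between the
Lagrangian and dual Lagrangian problems);
(2) `L` has saddle points `(w*, λ*)` with `λ* = λ_P` and
`w* ∈ (−(D−λ_P I)⁺d + N(D−λ_P I)) ∩ W` if `λ_P = ‖D‖`, or `w* = −(D−λ_P I)⁻¹d` if
`λ_P > ‖D‖`;
(3) the set of maximizers of `V` over `W` equals `w*`. -/
theorem stmt14 {n : ℕ} (D : Matrix (Fin n) (Fin n) ℝ) (hD : D.PosSemidef)
    (d : Fin n → ℝ) (lamP : ℝ)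
    (hlamP : IsGreatest
      {μ : ℝ | ∃ v : Fin n ⊕ Fin n → ℝ, v ≠ 0 ∧
        (Matrix.fromBlocks D 1 (Matrix.vecMulVec d d) D).mulVec v = μ • v} lamP)
    (Dp : Matrix (Fin n) (Fin n) ℝ) (hDp : IsMoorePenrose (D - lamP • 1) Dp) :
    let V : (Fin n → ℝ) → ℝ := fun w => (1/2) * (w ⬝ᵥ D.mulVec w) + w ⬝ᵥ d
    let L : (Fin n → ℝ) → ℝ → ℝ := fun w lam => V w - (1/2) * lam * (w ⬝ᵥ w - 1)
    let V0 : ℝ := -(1/2) * (d ⬝ᵥ Dp.mulVec d) + lamP / 2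
    -- (1) all three problems have solutions with common optimal value V⁰
    (IsGreatest {r | ∃ w : Fin n → ℝ, w ⬝ᵥ w = 1 ∧ r = V w} V0 ∧
     IsGreatest {r | ∃ w : Fin n → ℝ, IsLeast {s | ∃ lam : ℝ, s = L w lam} r} V0 ∧
     IsLeast {r | ∃ lam : ℝ, IsGreatest {s | ∃ w : Fin n → ℝ, s = L w lam} r} V0) ∧
    -- (2) saddle points of L
    ((lamP = specNorm D →
        ∀ w : Fin n → ℝ,
          (∃ q, (D - lamP • 1).mulVec q = 0 ∧ w = -Dp.mulVec d + q) → w ⬝ᵥ w = 1 →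
            (∀ w' : Fin n → ℝ, L w' lamP ≤ L w lamP) ∧
            (∀ lam : ℝ, L w lamP ≤ L w lam)) ∧
     (lamP > specNorm D →
        (∀ w' : Fin n → ℝ, L w' lamP ≤ L (-(D - lamP • 1)⁻¹.mulVec d) lamP) ∧
        (∀ lam : ℝ, L (-(D - lamP • 1)⁻¹.mulVec d) lamP ≤
          L (-(D - lamP • 1)⁻¹.mulVec d) lam))) ∧
    -- (3) the set of maximizers of V over W equals w*
    ((lamP = specNorm D →
        {w : Fin n → ℝ | w ⬝ᵥ w = 1 ∧ ∀ w', w' ⬝ᵥ w' = 1 → V w' ≤ V w} =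
          {w : Fin n → ℝ |
            (∃ q, (D - lamP • 1).mulVec q = 0 ∧ w = -Dp.mulVec d + q) ∧ w ⬝ᵥ w = 1}) ∧
     (lamP > specNorm D →
        {w : Fin n → ℝ | w ⬝ᵥ w = 1 ∧ ∀ w', w' ⬝ᵥ w' = 1 → V w' ≤ V w} =
          {-(D - lamP • 1)⁻¹.mulVec d})) := by
  intro V L V0
  have hDt : Dᵀ = D := by
    have := hD.isHermitian
    rwa [Matrix.IsHermitian, conjTranspose_eq_transpose_of_trivial] at this
  obtain ⟨hpsd, w0, hw0, hw0d⟩ := exists_w0 D hDt d lamP hlamP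
  have hA : ∀ z : Fin n → ℝ, (D - lamP • (1 : Matrix (Fin n) (Fin n) ℝ)) *ᵥ z = D *ᵥ z - lamP • z := by
    intro z; rw [sub_mulVec, smul_mulVec, one_mulVec]
  have hd : d = lamP • w0 - D *ᵥ w0 := by rw [← hw0d]; simp
  have hdA : d = -((D - lamP • (1 : Matrix (Fin n) (Fin n) ℝ)) *ᵥ w0) := by
    rw [hA, neg_sub]; exact hd
  -- `L` at `lamP` in completed-square form, around any solution
  have hL : ∀ w u : Fin n → ℝ, D *ᵥ u + d = lamP • u →
      L w lamP = L u lamP - (1/2) * (lamP * ((w - u) ⬝ᵥ (w - u)) - (w - u) ⬝ᵥ D *ᵥ (w - u)) := by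
    intro w u hu
    have hs := hsymm hDt u w
    have hd : d = lamP • u - D *ᵥ u := by rw [← hu]; simp
    have h1 : w ⬝ᵥ d = lamP * (w ⬝ᵥ u) - w ⬝ᵥ D *ᵥ u := by
      conv_lhs => rw [hd]
      simp [dotProduct_sub]
    have h2 : u ⬝ᵥ d = lamP * (u ⬝ᵥ u) - u ⬝ᵥ D *ᵥ u := by
      conv_lhs => rw [hd]
      simp [dotProduct_sub]
    simp only [L, V, sub_dotProduct, dotProduct_sub, mulVec_sub, hs, dotProduct_comm u w, h1, h2]
    ring
  have hLmax : ∀ u : Fin n → ℝ, D *ᵥ u + d = lamP • u → ∀ w, L w lamP ≤ L u lamP := by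
    intro u hu w
    rw [hL w u hu]
    linarith [hpsd (w - u)]
  have hLV : ∀ w : Fin n → ℝ, w ⬝ᵥ w = 1 → ∀ lam, L w lam = V w := by
    intro w hw lam
    simp [L, hw]
  have hVmax : ∀ w : Fin n → ℝ, w ⬝ᵥ w = 1 → V w ≤ V w0 := by
    intro w hw
    rw [← hLV w hw lamP, ← hLV w0 hw0 lamP]
    exact hLmax w0 hw0d w
  have hADA : ∀ z, (D - lamP • (1 : Matrix (Fin n) (Fin n) ℝ)) *ᵥ (Dp *ᵥ
      ((D - lamP • (1 : Matrix (Fin n) (Fin n) ℝ)) *ᵥ z)) =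
      (D - lamP • (1 : Matrix (Fin n) (Fin n) ℝ)) *ᵥ z := by
    intro z
    rw [mulVec_mulVec, mulVec_mulVec, hDp.1]
  have hAt : (D - lamP • (1 : Matrix (Fin n) (Fin n) ℝ))ᵀ = D - lamP • 1 := by
    simp [hDt]
  have hADd : (D - lamP • (1 : Matrix (Fin n) (Fin n) ℝ)) *ᵥ (Dp *ᵥ d) = d := by
    conv_lhs => rw [hdA, mulVec_neg, mulVec_neg, hADA]
    exact hdA.symm
  have hV0 : V0 = V w0 := by
    have h1 : d ⬝ᵥ Dp *ᵥ d = - (w0 ⬝ᵥ d) := by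
      have : d ⬝ᵥ Dp *ᵥ d =
          -(((D - lamP • (1 : Matrix (Fin n) (Fin n) ℝ)) *ᵥ w0) ⬝ᵥ Dp *ᵥ d) := by
        rw [← neg_dotProduct, ← hdA]
      rw [this, dotProduct_comm, hsymm hAt, hADd]
    have h2 : w0 ⬝ᵥ d = lamP * 1 - w0 ⬝ᵥ D *ᵥ w0 := by
      conv_lhs => rw [hd]
      simp [dotProduct_sub, hw0]
    simp only [V0, V, h1]
    linarith
  have hsol : ∀ w : Fin n → ℝ, (∃ q, (D - lamP • (1 : Matrix (Fin n) (Fin n) ℝ)).mulVec q = 0 ∧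
      w = -Dp.mulVec d + q) ↔ D *ᵥ w + d = lamP • w := by
    intro w
    have e : D *ᵥ w + d = lamP • w ↔ (D - lamP • (1 : Matrix (Fin n) (Fin n) ℝ)) *ᵥ w = -d := by
      rw [hA, sub_eq_iff_eq_add, ← eq_sub_iff_add_eq, neg_add_eq_sub]
    rw [e]
    constructor
    · rintro ⟨q, hq, rfl⟩
      rw [mulVec_add, mulVec_neg, hq, hADd, add_zero]
    · intro h
      exact ⟨w + Dp *ᵥ d, by rw [mulVec_add, hADd, h, neg_add_cancel], by simp⟩
  have hmaxset : ∀ w : Fin n → ℝ, (w ⬝ᵥ w = 1 ∧ ∀ w', w' ⬝ᵥ w' = 1 → V w' ≤ V w) ↔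
      (D *ᵥ w + d = lamP • w ∧ w ⬝ᵥ w = 1) := by
    intro w
    constructor
    · rintro ⟨hw, hm⟩
      refine ⟨?_, hw⟩
      have h1 := hL w w0 hw0d
      rw [hLV w hw, hLV w0 hw0] at h1
      have h2 := hm w0 hw0
      have h3 : (w - w0) ⬝ᵥ (lamP • (1 : Matrix (Fin n) (Fin n) ℝ) - D) *ᵥ (w - w0) = 0 := by
        rw [sub_mulVec, smul_mulVec, one_mulVec, dotProduct_sub, dotProduct_smul, smul_eq_mul]
        linarith [hpsd (w - w0)]
      have hM : (lamP • (1 : Matrix (Fin n) (Fin n) ℝ) - D).PosSemidef := by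
        apply Matrix.PosSemidef.of_dotProduct_mulVec_nonneg
        · rw [Matrix.IsHermitian, conjTranspose_eq_transpose_of_trivial]
          simp [hDt]
        · intro x
          rw [sub_mulVec, smul_mulVec, one_mulVec, dotProduct_sub, dotProduct_smul, smul_eq_mul,
            star_trivial]
          linarith [hpsd x]
      have h4 := (hM.dotProduct_mulVec_zero_iff (w - w0)).1 (by rw [star_trivial]; exact h3)
      rw [sub_mulVec, smul_mulVec, one_mulVec, smul_sub, mulVec_sub] at h4
      rw [hd]
      have h5 := sub_eq_zero.1 h4
      ext i
      have := congrFun h5 i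
      simp only [Pi.add_apply, Pi.sub_apply] at this ⊢
      linarith
    · rintro ⟨h, hw⟩
      refine ⟨hw, fun w' hw' => ?_⟩
      rw [← hLV w hw lamP, ← hLV w' hw' lamP]
      exact hLmax w h w'
  have hinv : lamP > specNorm D → ∀ w : Fin n → ℝ, D *ᵥ w + d = lamP • w ↔
      w = -(D - lamP • (1 : Matrix (Fin n) (Fin n) ℝ))⁻¹.mulVec d := by
    intro hgt
    have hu : IsUnit (D - lamP • (1 : Matrix (Fin n) (Fin n) ℝ)).det := by
      rw [isUnit_iff_ne_zero]
      intro hdet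
      obtain ⟨q, hq0, hq⟩ := Matrix.exists_mulVec_eq_zero_iff.2 hdet
      rw [hA, sub_eq_zero] at hq
      have hqq : 0 < q ⬝ᵥ q := by
        have := (dotProduct_star_self_pos_iff (v := q)).2 hq0
        simpa using this
      have hs : 0 < Real.sqrt (q ⬝ᵥ q) := Real.sqrt_pos.2 hqq
      set v : Fin n → ℝ := (Real.sqrt (q ⬝ᵥ q))⁻¹ • q with hv
      have hvv : v ⬝ᵥ v = 1 := by
        rw [hv, smul_dotProduct, dotProduct_smul, smul_eq_mul, smul_eq_mul, ← mul_assoc,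
          ← mul_inv, Real.mul_self_sqrt hqq.le, inv_mul_cancel₀ hqq.ne']
      have hDv : v ⬝ᵥ D *ᵥ v = lamP := by
        have : D *ᵥ v = lamP • v := by rw [hv, mulVec_smul, hq, smul_comm]
        rw [this, dotProduct_smul, hvv, smul_eq_mul, mul_one]
      have hbdd : BddAbove {r | ∃ v : Fin n → ℝ, v ⬝ᵥ v = 1 ∧ r = |v ⬝ᵥ D.mulVec v|} := by
        refine ⟨lamP, ?_⟩
        rintro r ⟨z, hz, rfl⟩
        have h0 : 0 ≤ z ⬝ᵥ D *ᵥ z := by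
          have := hD.dotProduct_mulVec_nonneg z
          rwa [star_trivial] at this
        rw [abs_of_nonneg h0]
        have := hpsd z
        rwa [hz, mul_one] at this
      have h1 : |v ⬝ᵥ D *ᵥ v| ≤ specNorm D := le_csSup hbdd ⟨v, hvv, rfl⟩
      rw [hDv] at h1
      linarith [le_abs_self lamP]
    intro w
    have e : D *ᵥ w + d = lamP • w ↔ (D - lamP • (1 : Matrix (Fin n) (Fin n) ℝ)) *ᵥ w = -d := by
      rw [hA, sub_eq_iff_eq_add, ← eq_sub_iff_add_eq, neg_add_eq_sub]
    rw [e]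
    constructor
    · intro h
      rw [← mulVec_neg, ← h, mulVec_mulVec, Matrix.nonsing_inv_mul _ hu, one_mulVec]
    · rintro rfl
      rw [mulVec_neg, mulVec_mulVec, Matrix.mul_nonsing_inv _ hu, one_mulVec]
  refine ⟨⟨⟨⟨w0, hw0, hV0⟩, ?_⟩, ⟨⟨w0, ?_⟩, ?_⟩, ⟨⟨lamP, ?_⟩, ?_⟩⟩, ⟨?_, ?_⟩, ?_, ?_⟩
  · rintro r ⟨w, hw, rfl⟩
    rw [hV0]; exact hVmax w hw
  · refine ⟨⟨0, by rw [hV0, hLV w0 hw0]⟩, ?_⟩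
    rintro r ⟨lam, rfl⟩
    rw [hV0, hLV w0 hw0]
  · rintro r ⟨w, ⟨lam, rfl⟩, hlb⟩
    have h1 : L w lam ≤ L w lamP := hlb ⟨lamP, rfl⟩
    rw [hV0, ← hLV w0 hw0 lamP]
    exact h1.trans (hLmax w0 hw0d w)
  · refine ⟨⟨w0, by rw [hV0, hLV w0 hw0]⟩, ?_⟩
    rintro r ⟨w, rfl⟩
    rw [hV0, ← hLV w0 hw0 lamP]
    exact hLmax w0 hw0d w
  · rintro r ⟨lam, _, hub⟩
    rw [hV0, ← hLV w0 hw0 lam]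
    exact hub ⟨w0, rfl⟩
  · intro _ w hw hww
    refine ⟨hLmax w ((hsol w).1 hw), fun lam => ?_⟩
    rw [hLV w hww, hLV w hww]
  · intro hgt
    rw [← (hinv hgt w0).1 hw0d]
    refine ⟨hLmax w0 hw0d, fun lam => ?_⟩
    rw [hLV w0 hw0, hLV w0 hw0]
  · intro _
    ext w
    simp only [Set.mem_ofPred_eq]
    rw [hmaxset, hsol]
  · intro hgt
    ext w
    simp only [Set.mem_ofPred_eq, Set.mem_singleton_iff]
    rw [hmaxset, ← hinv hgt w]
    constructor
    · exact fun h => h.1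
    · intro h
      refine ⟨h, ?_⟩
      rw [(hinv hgt w).1 h, ← (hinv hgt w0).1 hw0d, hw0]
end
end

section
/- Let D ∈ ℝ^{n×n} be positive semidefinite, d ∈ ℝ^n, L(w,λ) = (1/2)w'Dw + w'd − (1/2)λ(w'w − 1), and let λ_P be the largest real eigenvalue of P = [[D, I],[dd', D]]. Then: (1) the dual problem min_λ max_w L(w,λ) is equivalent to min_{λ ≥ ‖D‖} max_w L(w,λ) (for λ < ‖D‖ the inner supremum over w is +∞); (2) this dual problem has a solution for every such D and d, with optimal value L⁰ = −(1/2)d'(D − λ_P I)⁺d + λ_P/2; (3) the optimal multiplier is λ⁰ = λ_P, and the corresponding inner maximizer set is w⁰(λ⁰) = −(D − ‖D‖I)⁺d + N(D − ‖D‖I) if λ_P = ‖D‖, and w⁰(λ⁰) = −(D − λ_P I)^{−1}d if λ_P > ‖D‖. -/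
open Matrix Set

noncomputable section

lemma aux_lim (p : ℝ → ℝ) (hp : Continuous p) (h : ∀ e : ℝ, 0 < e → 0 ≤ p e) : 0 ≤ p 0 := by
  have h1 : Filter.Tendsto p (nhdsWithin 0 (Ioi 0)) (nhds (p 0)) :=
    (hp.tendsto 0).mono_left nhdsWithin_le_nhds
  refine ge_of_tendsto h1 ?_
  filter_upwards [self_mem_nhdsWithin] with e he using h e he

lemma aux_sphere_compact (n : ℕ) : IsCompact {v : Fin n → ℝ | v ⬝ᵥ v = 1} := by
  apply Metric.isCompact_of_isClosed_isBounded
  · exact isClosed_eq (by unfold dotProduct; fun_prop) continuous_const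
  · refine (Metric.isBounded_iff_subset_closedBall 0).2 ⟨1, ?_⟩
    intro v hv
    have hv' : v ⬝ᵥ v = 1 := hv
    rw [mem_closedBall_zero_iff, pi_norm_le_iff_of_nonneg zero_le_one]
    intro i
    have : v i * v i ≤ v ⬝ᵥ v :=
      Finset.single_le_sum (f := fun i => v i * v i) (fun j _ => mul_self_nonneg _)
        (Finset.mem_univ i)
    rw [Real.norm_eq_abs, abs_le]
    constructor <;> nlinarith

lemma aux_sphere_nonempty {n : ℕ} (hn : 0 < n) : {v : Fin n → ℝ | v ⬝ᵥ v = 1}.Nonempty :=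
  ⟨Pi.single ⟨0, hn⟩ 1, by simp⟩

lemma aux_symm {n : ℕ} {D : Matrix (Fin n) (Fin n) ℝ} (hD : Dᵀ = D)
    (x y : Fin n → ℝ) : x ⬝ᵥ D.mulVec y = y ⬝ᵥ D.mulVec x := by
  rw [dotProduct_mulVec, ← mulVec_transpose, hD, dotProduct_comm]

lemma aux_transpose {n : ℕ} {D : Matrix (Fin n) (Fin n) ℝ} (hD : D.PosSemidef) : Dᵀ = D := by
  have := hD.1
  rwa [IsHermitian, conjTranspose_eq_transpose_of_trivial] at this

lemma aux_nonneg {n : ℕ} {D : Matrix (Fin n) (Fin n) ℝ} (hD : D.PosSemidef) (x : Fin n → ℝ) :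
    0 ≤ x ⬝ᵥ D.mulVec x := by
  simpa using hD.dotProduct_mulVec_nonneg x

lemma aux_spec {n : ℕ} (hn : 0 < n) {D : Matrix (Fin n) (Fin n) ℝ} (hD : D.PosSemidef) :
    ∃ v : Fin n → ℝ, v ⬝ᵥ v = 1 ∧ v ⬝ᵥ D.mulVec v = specNorm D ∧
      ∀ x : Fin n → ℝ, x ⬝ᵥ D.mulVec x ≤ specNorm D * (x ⬝ᵥ x) := by
  have hc : Continuous fun v : Fin n → ℝ => v ⬝ᵥ D.mulVec v := by
    unfold mulVec dotProduct; fun_prop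
  obtain ⟨v, hv, hmax⟩ := (aux_sphere_compact n).exists_isMaxOn (aux_sphere_nonempty hn)
    hc.continuousOn
  have hs : specNorm D = v ⬝ᵥ D.mulVec v := by
    apply IsGreatest.csSup_eq
    refine ⟨⟨v, hv, (abs_of_nonneg (aux_nonneg hD v)).symm⟩, ?_⟩
    rintro r ⟨u, hu, rfl⟩
    rw [abs_of_nonneg (aux_nonneg hD u)]
    exact hmax hu
  refine ⟨v, hv, hs.symm, fun x => ?_⟩
  by_cases hx : x = 0
  · simp [hx]
  have hpos : 0 < x ⬝ᵥ x := by
    have h0 : 0 ≤ x ⬝ᵥ x := Finset.sum_nonneg fun i _ => mul_self_nonneg _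
    exact lt_of_le_of_ne h0 fun h => hx (dotProduct_self_eq_zero.1 h.symm)
  have hq := Real.sq_sqrt hpos.le
  have hqp := Real.sqrt_pos.2 hpos
  set t := √(x ⬝ᵥ x)
  have hu : (t⁻¹ • x) ⬝ᵥ (t⁻¹ • x) = 1 := by
    simp only [dotProduct_smul, smul_dotProduct, smul_eq_mul, ← hq]
    field_simp
  have := hmax (a := t⁻¹ • x) hu
  simp only [mem_setOf_eq, mulVec_smul, dotProduct_smul, smul_dotProduct, smul_eq_mul, ← hs] at this
  rw [← hq]
  calc x ⬝ᵥ D.mulVec x = t ^ 2 * (t⁻¹ * (t⁻¹ * (x ⬝ᵥ D.mulVec x))) := by field_simp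
    _ ≤ t ^ 2 * specNorm D := by gcongr
    _ = _ := by ring

/-- Trust region multiplier. -/
lemma aux_mult {n : ℕ} (hn : 0 < n) {D : Matrix (Fin n) (Fin n) ℝ} (hT : Dᵀ = D)
    (d : Fin n → ℝ) : ∃ (w : Fin n → ℝ) (l : ℝ), w ⬝ᵥ w = 1 ∧ D.mulVec w + d = l • w ∧
      ∀ x : Fin n → ℝ, x ⬝ᵥ D.mulVec x ≤ l * (x ⬝ᵥ x) := by
  have hc : Continuous fun v : Fin n → ℝ => (1/2) * (v ⬝ᵥ D.mulVec v) + v ⬝ᵥ d := by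
    unfold mulVec dotProduct; fun_prop
  obtain ⟨w, hw, hmax⟩ := (aux_sphere_compact n).exists_isMaxOn (aux_sphere_nonempty hn)
    hc.continuousOn
  have hw1 : w ⬝ᵥ w = 1 := hw
  set g := D.mulVec w + d with hg
  have key : ∀ h : Fin n → ℝ, 0 < w ⬝ᵥ h →
      (w ⬝ᵥ h) * (h ⬝ᵥ D.mulVec h) ≤ (h ⬝ᵥ h) * (h ⬝ᵥ g) := by
    intro h ha
    have hpos : 0 < h ⬝ᵥ h := by
      have h0 : 0 ≤ h ⬝ᵥ h := Finset.sum_nonneg fun i _ => mul_self_nonneg _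
      refine lt_of_le_of_ne h0 fun h' => ?_
      rw [dotProduct_self_eq_zero.1 h'.symm] at ha
      simp at ha
    obtain ⟨t, ht⟩ : ∃ t : ℝ, t * (h ⬝ᵥ h) = -2 * (w ⬝ᵥ h) :=
      ⟨-2 * (w ⬝ᵥ h) / (h ⬝ᵥ h), by field_simp⟩
    have hu : (w + t • h) ⬝ᵥ (w + t • h) = 1 := by
      simp only [dotProduct_add, add_dotProduct, dotProduct_smul, smul_dotProduct, smul_eq_mul,
        hw1, dotProduct_comm h w]
      linear_combination t * ht
    have := hmax (a := w + t • h) hu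
    simp only [mem_setOf_eq, mulVec_add, mulVec_smul, dotProduct_add, add_dotProduct,
      dotProduct_smul, smul_dotProduct, smul_eq_mul, aux_symm hT w h] at this
    have hhg : h ⬝ᵥ g = h ⬝ᵥ D.mulVec w + h ⬝ᵥ d := by rw [hg, dotProduct_add]
    rw [hhg]
    set a := w ⬝ᵥ h
    set b := h ⬝ᵥ h
    set q := h ⬝ᵥ D.mulVec h
    set c := h ⬝ᵥ D.mulVec w + h ⬝ᵥ d with hcdef
    have h1 : t * c + (1/2) * t^2 * q ≤ 0 := by rw [hcdef]; nlinarith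
    have h2 : (t * c + (1/2) * t^2 * q) * b^2 ≤ 0 :=
      mul_nonpos_of_nonpos_of_nonneg h1 (sq_nonneg b)
    have h3 : (t * c + (1/2) * t^2 * q) * b^2 = 2 * a * (a * q - b * c) := by
      linear_combination (c * b + (1/2) * q * (t * b - 2 * a)) * ht
    rw [h3] at h2
    by_contra hcon
    push Not at hcon
    have : 0 < 2 * a * (a * q - b * c) := by
      apply mul_pos (by linarith) (by linarith)
    linarith
  have half : ∀ e : Fin n → ℝ, w ⬝ᵥ e = 0 → 0 ≤ (e ⬝ᵥ e) * (e ⬝ᵥ g) := by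
    intro e he
    have := aux_lim (fun s => ((e + s • w) ⬝ᵥ (e + s • w)) * ((e + s • w) ⬝ᵥ g)
        - s * ((e + s • w) ⬝ᵥ D.mulVec (e + s • w)))
      (by unfold mulVec dotProduct; fun_prop) (by
        intro s hs
        have hws : w ⬝ᵥ (e + s • w) = s := by
          simp [dotProduct_add, he, hw1]
        have := key (e + s • w) (by rw [hws]; exact hs)
        rw [hws] at this
        linarith)
    simpa using this
  have orth : ∀ e : Fin n → ℝ, w ⬝ᵥ e = 0 → e ⬝ᵥ g = 0 := by
    intro e he
    by_cases hz : e = 0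
    · simp [hz]
    have hpos : 0 < e ⬝ᵥ e := by
      have h0 : 0 ≤ e ⬝ᵥ e := Finset.sum_nonneg fun i _ => mul_self_nonneg _
      exact lt_of_le_of_ne h0 fun h => hz (dotProduct_self_eq_zero.1 h.symm)
    have h1 := half e he
    have h2 := half (-e) (by simp [he])
    simp only [neg_dotProduct, dotProduct_neg, neg_neg] at h2
    have h3 := nonneg_of_mul_nonneg_right h1 hpos
    have h4 := nonneg_of_mul_nonneg_right h2 hpos
    linarith
  have hgl : g = (w ⬝ᵥ g) • w := by
    have h0 : w ⬝ᵥ (g - (w ⬝ᵥ g) • w) = 0 := by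
      simp [dotProduct_sub, hw1]
    have h1 := orth _ h0
    have h2 : (g - (w ⬝ᵥ g) • w) ⬝ᵥ (g - (w ⬝ᵥ g) • w) = 0 := by
      rw [dotProduct_sub, h1, dotProduct_smul, dotProduct_comm _ w, h0]; simp
    exact sub_eq_zero.1 (dotProduct_self_eq_zero.1 h2)
  refine ⟨w, w ⬝ᵥ g, hw1, hgl, ?_⟩
  set l := w ⬝ᵥ g
  have pos : ∀ h : Fin n → ℝ, 0 < w ⬝ᵥ h → h ⬝ᵥ D.mulVec h ≤ l * (h ⬝ᵥ h) := by
    intro h ha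
    have := key h ha
    rw [hgl, dotProduct_smul, smul_eq_mul, dotProduct_comm h w] at this
    refine le_of_mul_le_mul_left ?_ ha
    linarith
  have nonn : ∀ h : Fin n → ℝ, 0 ≤ w ⬝ᵥ h → h ⬝ᵥ D.mulVec h ≤ l * (h ⬝ᵥ h) := by
    intro h ha
    have := aux_lim (fun s => l * ((h + s • w) ⬝ᵥ (h + s • w))
        - ((h + s • w) ⬝ᵥ D.mulVec (h + s • w)))
      (by unfold mulVec dotProduct; fun_prop) (by
        intro s hs
        have hws : w ⬝ᵥ (h + s • w) = w ⬝ᵥ h + s := by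
          simp [dotProduct_add, hw1]
        have := pos (h + s • w) (by rw [hws]; linarith)
        linarith)
    simp only [zero_smul, add_zero] at this
    linarith
  intro x
  rcases le_total 0 (w ⬝ᵥ x) with h | h
  · exact nonn x h
  · have := nonn (-x) (by rw [dotProduct_neg]; linarith)
    simpa [mulVec_neg] using this

/-- Eigenvalues of the block matrix. -/
lemma aux_eig {n : ℕ} (D : Matrix (Fin n) (Fin n) ℝ) (d : Fin n → ℝ) (m : ℝ)
    (x y : Fin n → ℝ) :
    (Matrix.fromBlocks D 1 (Matrix.vecMulVec d d) D).mulVec (Sum.elim x y) = m • Sum.elim x y ↔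
      D.mulVec x + y = m • x ∧ (d ⬝ᵥ x) • d + D.mulVec y = m • y := by
  rw [fromBlocks_mulVec]
  have : m • Sum.elim x y = Sum.elim (m • x) (m • y) := by
    ext i; cases i <;> simp
  rw [this, Sum.elim_eq_iff]
  have h2 : (vecMulVec d d).mulVec x = (d ⬝ᵥ x) • d := by
    rw [vecMulVec_mulVec]; ext i; simp [mul_comm]
  simp [h2]

/-- Positive semidefinite kernel. -/
lemma aux_ker {n : ℕ} {D : Matrix (Fin n) (Fin n) ℝ} (hT : Dᵀ = D) {l : ℝ}
    (hl : ∀ x : Fin n → ℝ, x ⬝ᵥ D.mulVec x ≤ l * (x ⬝ᵥ x)) (v : Fin n → ℝ)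
    (hv : v ⬝ᵥ D.mulVec v = l * (v ⬝ᵥ v)) : D.mulVec v = l • v := by
  have hA : (l • (1 : Matrix (Fin n) (Fin n) ℝ) - D).PosSemidef := by
    refine PosSemidef.of_dotProduct_mulVec_nonneg ?_ ?_
    · rw [IsHermitian, conjTranspose_eq_transpose_of_trivial]; simp [hT]
    · intro x
      have := hl x
      simp [sub_mulVec, smul_mulVec, dotProduct_sub]
      linarith
  have := (hA.dotProduct_mulVec_zero_iff v).1 (by
    simp [sub_mulVec, smul_mulVec, dotProduct_sub]; linarith)
  rw [sub_mulVec, smul_mulVec, one_mulVec, sub_eq_zero] at this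
  exact this.symm

/-- At the largest eigenvalue there is a unit-norm stationary point. -/
lemma aux_main {n : ℕ} (hn : 0 < n) (D : Matrix (Fin n) (Fin n) ℝ) (hD : D.PosSemidef)
    (d : Fin n → ℝ) (lamP : ℝ)
    (hlamP : IsGreatest
      {μ : ℝ | ∃ v : Fin n ⊕ Fin n → ℝ, v ≠ 0 ∧
        (Matrix.fromBlocks D 1 (Matrix.vecMulVec d d) D).mulVec v = μ • v} lamP) :
    specNorm D ≤ lamP ∧ ∃ w : Fin n → ℝ, w ⬝ᵥ w = 1 ∧ D.mulVec w + d = lamP • w := by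
  have hT := aux_transpose hD
  obtain ⟨v, hv1, hvs, hs⟩ := aux_spec hn hD
  obtain ⟨w, l, hw1, hwl, hl⟩ := aux_mult hn hT d
  have hv0 : v ≠ 0 := by rintro rfl; simp at hv1
  have hvk : D.mulVec v = specNorm D • v := aux_ker hT hs v (by rw [hvs, hv1, mul_one])
  have hsl : specNorm D ≤ l := by
    have := hl v
    rwa [hvs, hv1, mul_one] at this
  have hd : d = l • w - D.mulVec w := by rw [← hwl]; abel
  have hlP : l ≤ lamP := by
    rcases hsl.eq_or_lt with h | h
    · -- the top eigenvector of D
      apply hlamP.2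
      refine ⟨Sum.elim v 0, fun h0 => hv0 ?_, (aux_eig D d l v 0).2 ⟨?_, ?_⟩⟩
      · ext i; exact congrFun h0 (Sum.inl i)
      · rw [hvk, h, add_zero]
      · have : d ⬝ᵥ v = 0 := by
          rw [dotProduct_comm, hd, dotProduct_sub, aux_symm hT, hvk, h, dotProduct_smul,
            dotProduct_smul, dotProduct_comm w v, sub_self]
        simp [this]
    · have hdet : (l • (1 : Matrix (Fin n) (Fin n) ℝ) - D).det ≠ 0 := by
        intro h0
        obtain ⟨x, hx0, hx⟩ := exists_mulVec_eq_zero_iff.2 h0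
        rw [sub_mulVec, smul_mulVec, one_mulVec, sub_eq_zero] at hx
        have h1 := hs x
        rw [← hx, dotProduct_smul, smul_eq_mul] at h1
        have hpos : 0 < x ⬝ᵥ x := by
          have h0 : 0 ≤ x ⬝ᵥ x := Finset.sum_nonneg fun i _ => mul_self_nonneg _
          exact lt_of_le_of_ne h0 fun h => hx0 (dotProduct_self_eq_zero.1 h.symm)
        nlinarith
      obtain ⟨x, hx⟩ : ∃ x, (l • (1 : Matrix (Fin n) (Fin n) ℝ) - D).mulVec x = w := by
        refine ⟨(l • (1 : Matrix (Fin n) (Fin n) ℝ) - D)⁻¹.mulVec w, ?_⟩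
        rw [mulVec_mulVec, mul_nonsing_inv _ (isUnit_iff_ne_zero.2 hdet), one_mulVec]
      rw [sub_mulVec, smul_mulVec, one_mulVec] at hx
      apply hlamP.2
      refine ⟨Sum.elim x w, fun h0 => ?_, (aux_eig D d l x w).2 ⟨?_, ?_⟩⟩
      · have : w = 0 := by ext i; exact congrFun h0 (Sum.inr i)
        rw [this] at hw1; simp at hw1
      · rw [← hx]; abel
      · have : d ⬝ᵥ x = 1 := by
          rw [dotProduct_comm, hd, dotProduct_sub, aux_symm hT, dotProduct_smul,
            dotProduct_comm x w, ← dotProduct_smul, ← dotProduct_sub, hx, hw1]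
        rw [this, one_smul, add_comm, hwl]
  refine ⟨hsl.trans hlP, ?_⟩
  rcases (hsl.trans hlP).eq_or_lt with h | h
  · have : l = lamP := le_antisymm hlP (h ▸ hsl)
    exact ⟨w, hw1, this ▸ hwl⟩
  · obtain ⟨z, hz0, hz⟩ := hlamP.1
    obtain ⟨x, y, rfl⟩ : ∃ x y : Fin n → ℝ, z = Sum.elim x y :=
      ⟨z ∘ Sum.inl, z ∘ Sum.inr, (Sum.elim_comp_inl_inr z).symm⟩
    obtain ⟨e1, e2⟩ := (aux_eig D d lamP x y).1 hz
    have inj : ∀ u : Fin n → ℝ, D.mulVec u = lamP • u → u = 0 := by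
      intro u hu
      have h1 := hs u
      rw [hu, dotProduct_smul, smul_eq_mul] at h1
      by_contra hne
      have hpos : 0 < u ⬝ᵥ u := by
        have h0 : 0 ≤ u ⬝ᵥ u := Finset.sum_nonneg fun i _ => mul_self_nonneg _
        exact lt_of_le_of_ne h0 fun h => hne (dotProduct_self_eq_zero.1 h.symm)
      nlinarith
    have hc : d ⬝ᵥ x ≠ 0 := by
      intro hc
      rw [hc, zero_smul, zero_add] at e2
      have hy := inj y e2
      rw [hy, add_zero] at e1
      have hx := inj x e1
      apply hz0
      rw [hx, hy]; ext i; cases i <;> simp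
    set c := d ⬝ᵥ x with hcdef
    have hyy : y ⬝ᵥ y = c ^ 2 := by
      have hy : y = lamP • x - D.mulVec x := by rw [← e1]; abel
      have hcd : c • d = lamP • y - D.mulVec y := by rw [← e2]; abel
      calc y ⬝ᵥ y = y ⬝ᵥ (lamP • x - D.mulVec x) := by rw [← hy]
        _ = x ⬝ᵥ (lamP • y - D.mulVec y) := by
          rw [dotProduct_sub, dotProduct_sub, aux_symm hT y x, dotProduct_smul, dotProduct_smul,
            dotProduct_comm y x]
        _ = c ^ 2 := by
          rw [← hcd, dotProduct_smul, dotProduct_comm x d, ← hcdef, smul_eq_mul, sq]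
    refine ⟨c⁻¹ • y, ?_, ?_⟩
    · simp only [dotProduct_smul, smul_dotProduct, smul_eq_mul, hyy]
      field_simp
    · rw [mulVec_smul, smul_comm, ← e2, smul_add, smul_smul, inv_mul_cancel₀ hc, one_smul,
        add_comm]

/-- Dual Lagrangian of constrained quadratic optimization: for `D ⪰ 0`,
`L(w,λ) = (1/2)w'Dw + w'd − (1/2)λ(w'w−1)`, and `λ_P` the largest real eigenvalue of
`P = [[D,I],[dd',D]]`:
(1) for `λ < ‖D‖` the inner supremum over `w` is `+∞` (so the dual problem
`min_λ max_w L` is equivalent to `min_{λ ≥ ‖D‖} max_w L`);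
(2) the dual problem has a solution with optimal value
`L⁰ = −(1/2)d'(D−λ_P I)⁺d + λ_P/2`;
(3) the optimal multiplier is `λ⁰ = λ_P`, with inner maximizer set
`−(D−‖D‖I)⁺d + N(D−‖D‖I)` if `λ_P = ‖D‖` and `{−(D−λ_P I)⁻¹d}` if `λ_P > ‖D‖`. -/
theorem stmt16 {n : ℕ} (D : Matrix (Fin n) (Fin n) ℝ) (hD : D.PosSemidef)
    (d : Fin n → ℝ) (lamP : ℝ)
    (hlamP : IsGreatest
      {μ : ℝ | ∃ v : Fin n ⊕ Fin n → ℝ, v ≠ 0 ∧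
        (Matrix.fromBlocks D 1 (Matrix.vecMulVec d d) D).mulVec v = μ • v} lamP)
    (Dp : Matrix (Fin n) (Fin n) ℝ) (hDp : IsMoorePenrose (D - lamP • 1) Dp)
    (DNp : Matrix (Fin n) (Fin n) ℝ)
    (hDNp : IsMoorePenrose (D - specNorm D • 1) DNp) :
    let L : (Fin n → ℝ) → ℝ → ℝ := fun w lam =>
      (1/2) * (w ⬝ᵥ D.mulVec w) + w ⬝ᵥ d - (1/2) * lam * (w ⬝ᵥ w - 1)
    let L0 : ℝ := -(1/2) * (d ⬝ᵥ Dp.mulVec d) + lamP / 2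
    -- (1) for λ < ‖D‖ the inner supremum over w is +∞
    (∀ lam : ℝ, lam < specNorm D → ¬ BddAbove {s | ∃ w : Fin n → ℝ, s = L w lam}) ∧
    ({r | ∃ lam : ℝ, IsGreatest {s | ∃ w : Fin n → ℝ, s = L w lam} r} =
      {r | ∃ lam : ℝ, lam ≥ specNorm D ∧
        IsGreatest {s | ∃ w : Fin n → ℝ, s = L w lam} r}) ∧
    -- (2) the dual problem has a solution with optimal value L⁰
    IsLeast {r | ∃ lam : ℝ, IsGreatest {s | ∃ w : Fin n → ℝ, s = L w lam} r} L0 ∧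
    -- (3) the optimal multiplier λ⁰ = λ_P attains the minimum …
    IsGreatest {s | ∃ w : Fin n → ℝ, s = L w lamP} L0 ∧
    -- … with inner maximizer set given by the two cases
    ((lamP = specNorm D →
        {w : Fin n → ℝ | IsGreatest {s | ∃ w' : Fin n → ℝ, s = L w' lamP} (L w lamP)} =
          {w : Fin n → ℝ | ∃ q, (D - specNorm D • 1).mulVec q = 0 ∧
            w = -DNp.mulVec d + q}) ∧
     (lamP > specNorm D →
        {w : Fin n → ℝ | IsGreatest {s | ∃ w' : Fin n → ℝ, s = L w' lamP} (L w lamP)} =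
          {-(D - lamP • 1)⁻¹.mulVec d})) := by
  intro L L0
  have hn : 0 < n := by
    rcases Nat.eq_zero_or_pos n with h | h
    · subst h
      obtain ⟨v, hv, -⟩ := hlamP.1
      exact absurd (Subsingleton.elim v 0) hv
    · exact h
  have hT := aux_transpose hD
  obtain ⟨v, hv1, hvs, hs⟩ := aux_spec hn hD
  obtain ⟨hsP, w, hw1, hw⟩ := aux_main hn D hD d lamP hlamP
  have hle : ∀ x : Fin n → ℝ, x ⬝ᵥ D.mulVec x ≤ lamP * (x ⬝ᵥ x) := by
    intro x
    have h0 : 0 ≤ x ⬝ᵥ x := Finset.sum_nonneg fun i _ => mul_self_nonneg _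
    exact (hs x).trans (mul_le_mul_of_nonneg_right hsP h0)
  have hd : d = lamP • w - D.mulVec w := by rw [← hw]; abel
  have hA : ∀ (m : ℝ) (x : Fin n → ℝ), (D - m • 1).mulVec x = D.mulVec x - m • x := by
    intro m x; rw [sub_mulVec, smul_mulVec, one_mulVec]
  have part1 : ∀ lam : ℝ, lam < specNorm D →
      ¬ BddAbove {s | ∃ w : Fin n → ℝ, s = L w lam} := by
    rintro lam hlam ⟨B, hB⟩
    have hL : ∀ t : ℝ, L (t • v) lam =
        (1/2) * t^2 * (specNorm D - lam) + t * (v ⬝ᵥ d) + lam / 2 := by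
      intro t
      simp only [L, mulVec_smul, dotProduct_smul, smul_dotProduct, smul_eq_mul, hvs, hv1]
      ring
    have hb : ∀ t : ℝ, t^2 * (specNorm D - lam) + lam ≤ 2 * B := by
      intro t
      have h1 := hB ⟨t • v, rfl⟩
      have h2 := hB ⟨(-t) • v, rfl⟩
      rw [hL] at h1 h2
      nlinarith
    have hpos : 0 < specNorm D - lam := by linarith
    have hq : 0 < (|2 * B - lam| + 1) / (specNorm D - lam) := by positivity
    have h3 := hb (√((|2 * B - lam| + 1) / (specNorm D - lam)))
    rw [Real.sq_sqrt hq.le, div_mul_cancel₀ _ hpos.ne'] at h3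
    linarith [le_abs_self (2 * B - lam)]
  have hval : L w lamP = L0 := by
    have hAw : (D - lamP • 1).mulVec w = -d := by rw [hA, hd]; abel
    have hTA : (D - lamP • (1 : Matrix (Fin n) (Fin n) ℝ))ᵀ = D - lamP • 1 := by simp [hT]
    have h1 : d ⬝ᵥ Dp.mulVec d = w ⬝ᵥ (D - lamP • 1).mulVec w := by
      have hd' : d = -(D - lamP • 1).mulVec w := by rw [hAw, neg_neg]
      conv_lhs => rw [hd']
      rw [mulVec_neg, neg_dotProduct, dotProduct_neg, neg_neg, dotProduct_comm,
        aux_symm hTA, mulVec_mulVec, mulVec_mulVec, hDp.1]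
    rw [hAw, dotProduct_neg] at h1
    have h2 : w ⬝ᵥ D.mulVec w + w ⬝ᵥ d = lamP := by
      rw [← dotProduct_add, hw, dotProduct_smul, hw1, smul_eq_mul, mul_one]
    simp only [L, L0, h1, hw1]
    linarith
  have hquad : ∀ u : Fin n → ℝ, L u lamP = L0 -
      (1/2) * (lamP * ((u - w) ⬝ᵥ (u - w)) - (u - w) ⬝ᵥ D.mulVec (u - w)) := by
    intro u
    rw [← hval]
    simp only [L]
    have e1 : u ⬝ᵥ d = lamP * (u ⬝ᵥ w) - u ⬝ᵥ D.mulVec w := by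
      rw [hd, dotProduct_sub, dotProduct_smul, smul_eq_mul]
    have e2 : w ⬝ᵥ d = lamP * (w ⬝ᵥ w) - w ⬝ᵥ D.mulVec w := by
      conv_lhs => rw [hd]
      rw [dotProduct_sub, dotProduct_smul, smul_eq_mul]
    rw [e1, e2]
    simp only [mulVec_sub, dotProduct_sub, sub_dotProduct, aux_symm hT w u, dotProduct_comm w u]
    ring
  have part3 : IsGreatest {s | ∃ w : Fin n → ℝ, s = L w lamP} L0 := by
    refine ⟨⟨w, hval.symm⟩, ?_⟩
    rintro s ⟨u, rfl⟩
    rw [hquad]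
    linarith [hle (u - w)]
  have hmaxi : ∀ u : Fin n → ℝ, IsGreatest {s | ∃ w' : Fin n → ℝ, s = L w' lamP} (L u lamP) ↔
      (D - lamP • 1).mulVec u = -d := by
    intro u
    have h1 : IsGreatest {s | ∃ w' : Fin n → ℝ, s = L w' lamP} (L u lamP) ↔ L u lamP = L0 :=
      ⟨fun h => h.unique part3, fun h => h ▸ part3⟩
    rw [h1, hquad]
    have h2 : (D - lamP • 1).mulVec u = -d ↔ D.mulVec (u - w) = lamP • (u - w) := by
      rw [hA, hd, mulVec_sub, smul_sub, ← sub_eq_zero, ← sub_eq_zero (b := lamP • u - lamP • w)]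
      apply Eq.congr _ rfl
      abel
    rw [h2]
    constructor
    · intro h
      exact aux_ker hT hle _ (by linarith)
    · intro h
      rw [h, dotProduct_smul, smul_eq_mul]; ring
  refine ⟨part1, ?_, ⟨⟨lamP, part3⟩, ?_⟩, part3, ?_, ?_⟩
  · ext r
    constructor
    · rintro ⟨lam, h⟩
      refine ⟨lam, ?_, h⟩
      by_contra hlt
      exact part1 lam (not_le.1 hlt) ⟨r, h.2⟩
    · rintro ⟨lam, -, h⟩
      exact ⟨lam, h⟩
  · rintro r ⟨lam, h⟩
    have h1 : L w lam ≤ r := h.2 ⟨w, rfl⟩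
    have h2 : L w lam = L w lamP := by simp only [L, hw1]; ring
    rw [← hval, ← h2]
    exact h1
  · intro heq
    ext u
    rw [mem_setOf_eq, hmaxi, mem_setOf_eq]
    rw [← heq] at hDNp ⊢
    have hAw : (D - lamP • 1).mulVec w = -d := by rw [hA, hd]; abel
    have hp : (D - lamP • 1).mulVec (-DNp.mulVec d) = -d := by
      have hd' : d = -(D - lamP • 1).mulVec w := by rw [hAw, neg_neg]
      conv_lhs => rw [hd']
      rw [mulVec_neg, mulVec_neg, mulVec_neg, neg_neg, mulVec_mulVec, mulVec_mulVec, hDNp.1, hAw]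
    constructor
    · intro hu
      refine ⟨u - (-DNp.mulVec d), ?_, by abel⟩
      rw [mulVec_sub, hu, hp, sub_self]
    · rintro ⟨q, hq, rfl⟩
      rw [mulVec_add, hp, hq, add_zero]
  · intro hgt
    ext u
    rw [mem_setOf_eq, hmaxi, mem_singleton_iff]
    have hdet : (D - lamP • (1 : Matrix (Fin n) (Fin n) ℝ)).det ≠ 0 := by
      intro h0
      obtain ⟨x, hx0, hx⟩ := exists_mulVec_eq_zero_iff.2 h0
      rw [hA, sub_eq_zero] at hx
      have h1 := hs x
      rw [hx, dotProduct_smul, smul_eq_mul] at h1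
      have hpos : 0 < x ⬝ᵥ x := by
        have h0 : 0 ≤ x ⬝ᵥ x := Finset.sum_nonneg fun i _ => mul_self_nonneg _
        exact lt_of_le_of_ne h0 fun h => hx0 (dotProduct_self_eq_zero.1 h.symm)
      nlinarith
    have hU := isUnit_iff_ne_zero.2 hdet
    constructor
    · intro hu
      rw [← mulVec_neg, ← hu, mulVec_mulVec, nonsing_inv_mul _ hU, one_mulVec]
    · rintro rfl
      rw [mulVec_neg, mulVec_mulVec, mul_nonsing_inv _ hU, one_mulVec]
end
end
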